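/- arXiv:1602.00476 — 2 statements merged into one kernel-verified Lean document; each statement's English description precedes it below -/
import Mathlib

section
/- If Spoiler wins the slope game from position ((p,p'),(ρ,ρ')), then Spoiler wins the simulation game from every position (pm, p'm') such that (m,m') is C-below (ρ,ρ'), where C is 1 plus the maximal length of an acyclic path in the product graph of the two nets. -/
/-- A one-counter net over control states `Q` and actions `A`:
transitions carry a counter effect in `{-1, 0, 1}`. -/
structure OCN (Q A : Type) where
  δ : Q → A → ℤ → Q → Prop
  effect_bounded : ∀ p a d q, δ p a d q → d = -1 ∨ d = 0 ∨ d = 1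

namespace OCN

/-- The step relation of the LTS induced by a one-counter net on
configurations `Q × ℕ`:  `(p,m) →a (q,n)` iff there is a transition
`(p,a,d,q)` with `n = m + d ≥ 0`. -/
def Step {Q A : Type} (N : OCN Q A) (c : Q × ℕ) (a : A) (c' : Q × ℕ) : Prop :=
  ∃ d : ℤ, N.δ c.1 a d c'.1 ∧ (c'.2 : ℤ) = (c.2 : ℤ) + d

/-- An OCN is complete if every state has an `a`-labelled outgoing transition
for every action `a`. -/
def Complete {Q A : Type} (N : OCN Q A) : Prop :=
  ∀ p a, ∃ d q, N.δ p a d q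

/-- An OCN is non-blocking if every state has an outgoing transition with
counter effect in `{0, 1}`. -/
def NonBlocking {Q A : Type} (N : OCN Q A) : Prop :=
  ∀ p, ∃ a d q, N.δ p a d q ∧ (d = 0 ∨ d = 1)

end OCN

/-- `R` is a strong simulation between two labelled transition systems. -/
def IsSimulation {S S' A : Type} (stepL : S → A → S → Prop) (stepR : S' → A → S' → Prop)
    (R : S → S' → Prop) : Prop :=
  ∀ c c', R c c' → ∀ a d, stepL c a d → ∃ d', stepR c' a d' ∧ R d d'

/-- The strong simulation preorder `⪯`: the largest strong simulation,
i.e. the union of all strong simulations. -/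
def Simulates {S S' A : Type} (stepL : S → A → S → Prop) (stepR : S' → A → S' → Prop)
    (c : S) (c' : S') : Prop :=
  ∃ R, IsSimulation stepL stepR R ∧ R c c'

/-- A vector `(ρ,ρ')` is positive if both components are nonnegative and it
is not the zero vector. -/
def PosVec (ρ ρ' : ℝ) : Prop := 0 ≤ ρ ∧ 0 ≤ ρ' ∧ ¬(ρ = 0 ∧ ρ' = 0)

/-- `(α,α')` is behind `(ρ,ρ')`: the clockwise angle from `(ρ,ρ')` to
`(α,α')` is strictly between 0° and 180°, equivalently the cross product
`ρ·α' − ρ'·α` is strictly negative. -/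
def Behind (ρ ρ' α α' : ℝ) : Prop := ρ * α' - ρ' * α < 0

/-- The point `(n,n')` is `c`-above the vector `(ρ,ρ')`. -/
def CAbove (c ρ ρ' : ℝ) (n n' : ℤ) : Prop :=
  ∃ r : ℝ, 0 < r ∧ (n : ℝ) < r * ρ - c ∧ r * ρ' + c < (n' : ℝ)

/-- The point `(n,n')` is `c`-below the vector `(ρ,ρ')`. -/
def CBelow (c ρ ρ' : ℝ) (n n' : ℤ) : Prop :=
  ∃ r : ℝ, 0 < r ∧ r * ρ + c < (n : ℝ) ∧ (n' : ℝ) < r * ρ' - c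

/-- A step in the product graph of two OCNs: a common action label, the two
counter effects, and the target node. -/
abbrev PStep (Q Q' A : Type) := A × ℤ × ℤ × (Q × Q')

/-- Target node of a product-graph step. -/
def stepTgt {Q Q' A : Type} (s : PStep Q Q' A) : Q × Q' := s.2.2.2

/-- End node of a path given by a source node and a list of steps. -/
def pathEnd {Q Q' A : Type} (v : Q × Q') : List (PStep Q Q' A) → Q × Q'
  | [] => v
  | s :: rest => pathEnd (stepTgt s) rest

/-- The list of nodes visited by a path. -/
def pathNodes {Q Q' A : Type} (v : Q × Q') (steps : List (PStep Q Q' A)) :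
    List (Q × Q') :=
  v :: steps.map stepTgt

/-- Validity of a path in the product graph of `N` and `N'`: every step is a
pair of equally labelled transitions of the two nets. -/
def IsProdPath {Q Q' A : Type} (N : OCN Q A) (N' : OCN Q' A) :
    Q × Q' → List (PStep Q Q' A) → Prop
  | _, [] => True
  | v, s :: rest =>
      N.δ v.1 s.1 s.2.1 (stepTgt s).1 ∧ N'.δ v.2 s.1 s.2.2.1 (stepTgt s).2 ∧
      IsProdPath N N' (stepTgt s) rest

/-- The set of numbers of the form (length of an acyclic path in the product
graph) + 1; its greatest element is the constant `C` of the Belt Theorem. -/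
def AcyclicLenSet {Q Q' A : Type} (N : OCN Q A) (N' : OCN Q' A) : Set ℕ :=
  {k | ∃ v steps, IsProdPath N N' v steps ∧ (pathNodes v steps).Nodup ∧
        steps.length + 1 = k}

/-- A path is a lasso if it contains a cycle while no strict prefix does:
all nodes but the last one are pairwise distinct, and the last node repeats
an earlier one. -/
def IsLasso {Q Q' A : Type} (v : Q × Q') (steps : List (PStep Q Q' A)) : Prop :=
  steps ≠ [] ∧ (pathNodes v steps.dropLast).Nodup ∧
    pathEnd v steps ∈ pathNodes v steps.dropLast

/-- The pair of cumulative counter effects (Spoiler side, Duplicator side)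
of a list of product-graph steps. -/
def effectsOf {Q Q' A : Type} (steps : List (PStep Q Q' A)) : ℤ × ℤ :=
  ((steps.map fun s => s.2.1).sum, (steps.map fun s => s.2.2.1).sum)

/-- Spoiler has a winning strategy in the slope game from the position given
by the current (acyclic) path `(v, steps)` of the phase and the current slope
`(ρ, ρ')`.  In each round Spoiler picks a transition of `N` from the current
node and, for every equally labelled response transition of `N'`: if the
extended path is not yet a lasso, Spoiler keeps winning from the extended
position; if it is a lasso, decomposing it as `pre ++ cyc` where `cyc` is the
cycle (the unique nonempty suffix returning to the end node), the effect of
the cycle must be behind `(ρ, ρ')` (otherwise Duplicator wins immediately),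
and if this effect is moreover positive the game continues — and Spoiler keeps
winning — from the new phase starting at the final node with the cycle effect
as the new slope. -/
inductive SlopeSpoilerWins {Q Q' A : Type} (N : OCN Q A) (N' : OCN Q' A) :
    Q × Q' → List (PStep Q Q' A) → ℝ → ℝ → Prop where
  | move (v : Q × Q') (steps : List (PStep Q Q' A)) (ρ ρ' : ℝ)
      (a : A) (d : ℤ) (p : Q)
      (ht : N.δ (pathEnd v steps).1 a d p)
      (hcont : ∀ (d' : ℤ) (p' : Q'), N'.δ (pathEnd v steps).2 a d' p' →
        ¬ IsLasso v (steps ++ [(a, d, d', (p, p'))]) →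
        SlopeSpoilerWins N N' v (steps ++ [(a, d, d', (p, p'))]) ρ ρ')
      (hbehind : ∀ (d' : ℤ) (p' : Q'), N'.δ (pathEnd v steps).2 a d' p' →
        IsLasso v (steps ++ [(a, d, d', (p, p'))]) →
        ∀ pre cyc, steps ++ [(a, d, d', (p, p'))] = pre ++ cyc → cyc ≠ [] →
        pathEnd v pre = pathEnd v (steps ++ [(a, d, d', (p, p'))]) →
        Behind ρ ρ' ((effectsOf cyc).1 : ℝ) ((effectsOf cyc).2 : ℝ))
      (hnext : ∀ (d' : ℤ) (p' : Q'), N'.δ (pathEnd v steps).2 a d' p' →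
        IsLasso v (steps ++ [(a, d, d', (p, p'))]) →
        ∀ pre cyc, steps ++ [(a, d, d', (p, p'))] = pre ++ cyc → cyc ≠ [] →
        pathEnd v pre = pathEnd v (steps ++ [(a, d, d', (p, p'))]) →
        PosVec ((effectsOf cyc).1 : ℝ) ((effectsOf cyc).2 : ℝ) →
        SlopeSpoilerWins N N' (p, p') []
          ((effectsOf cyc).1 : ℝ) ((effectsOf cyc).2 : ℝ)) :
      SlopeSpoilerWins N N' v steps ρ ρ'

/-- Spoiler has a winning strategy in the simulation game from `(c, c')`:
she can pick a step such that after every response of Duplicator she again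
wins; in particular she wins immediately when Duplicator has no response. -/
inductive SpoilerWinsSim {Q Q' A : Type} (N : OCN Q A) (N' : OCN Q' A) :
    Q × ℕ → Q' × ℕ → Prop where
  | move (c : Q × ℕ) (c' : Q' × ℕ) (a : A) (d : Q × ℕ)
      (hs : N.Step c a d)
      (h : ∀ d', N'.Step c' a d' → SpoilerWinsSim N N' d d') :
      SpoilerWinsSim N N' c c'

theorem pos_of_mul_pos_left' {a b : ℝ} (ha : 0 ≤ a) (h : 0 < a * b) : 0 < b := by
  by_contra hb
  have := mul_nonneg ha (neg_nonneg.2 (not_lt.1 hb))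
  linarith

theorem drop_lemma (f : ℕ → ℤ) (K : ℕ) (h : ∀ k, K ≤ k → f (k+1) ≤ f k - 1) :
    ∀ j : ℕ, f (K + j) ≤ f K - j := by
  intro j
  induction j with
  | zero => simp
  | succ j ih =>
    have := h (K+j) (by omega)
    rw [← add_assoc]
    push_cast
    omega

/-- Bound constant. -/
def LBound (C : ℕ) : ℤ := 2 * C * ((C + 1) * (2 * C) + 1)

/-- Cycle relation between consecutive base points. -/
def CycRel (C : ℕ) (σ σ' : ℝ) (B1 B : ℤ × ℤ) : Prop :=
  ∃ x y : ℤ, B1.1 = B.1 + x ∧ B1.2 = B.2 + y ∧ |x| ≤ C ∧ |y| ≤ C ∧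
    σ * y - σ' * x < 0 ∧ -(C : ℤ) ≤ B1.2 ∧
    ((0 ≤ x ∧ 0 ≤ y) → -LBound C ≤ (C + 1) * (x * B1.2 - y * B1.1) - B1.1)

theorem behind_y_neg {σ σ' : ℝ} (h0 : 0 ≤ σ) (h1 : 0 < σ') {x y : ℤ}
    (hb : σ * y - σ' * x < 0) (hn : ¬ (0 ≤ x ∧ 0 ≤ y)) : y < 0 := by
  by_contra hy
  push Not at hy
  have hx : x < 0 := by
    by_contra hx
    exact hn ⟨by omega, hy⟩
  have hx' : (x : ℝ) < 0 := by exact_mod_cast hx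
  have hy' : (0 : ℝ) ≤ y := by exact_mod_cast hy
  nlinarith [mul_nonneg h0 hy', mul_pos h1 (neg_pos.2 hx')]

theorem behind_x_pos {σ σ' : ℝ} (h0 : 0 ≤ σ) (h1 : 0 < σ') {x y : ℤ}
    (hb : σ * y - σ' * x < 0) (hn : 0 ≤ x ∧ 0 ≤ y) : 0 < x := by
  have hy' : (0 : ℝ) ≤ y := by exact_mod_cast hn.2
  have : 0 < σ' * x := by nlinarith [mul_nonneg h0 hy']
  have := pos_of_mul_pos_left' h1.le this
  exact_mod_cast this

theorem behind_cross {σ σ' : ℝ} (h0 : 0 ≤ σ) (h1 : 0 < σ') {x y a a' : ℤ}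
    (hb : σ * y - σ' * x < 0) (hn : ¬ (0 ≤ x ∧ 0 ≤ y))
    (ha : σ * a' - σ' * a < 0) (hp : 0 ≤ a ∧ 0 ≤ a') : a * y - a' * x < 0 := by
  have hy := behind_y_neg h0 h1 hb hn
  have hap := behind_x_pos h0 h1 ha hp
  by_cases hx : 0 ≤ x
  · nlinarith [mul_nonneg hp.2 hx, mul_pos hap (neg_pos.2 hy)]
  · push Not at hx
    have hx' : (x : ℝ) < 0 := by exact_mod_cast hx
    have hy' : (y : ℝ) < 0 := by exact_mod_cast hy
    have hap' : (0 : ℝ) < a := by exact_mod_cast hap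
    have e1 := mul_pos hap' (sub_pos.2 hb)
    have e2 := mul_pos (neg_pos.2 hx') (sub_pos.2 ha)
    have : 0 < σ * (a' * x - a * y) := by nlinarith
    have := pos_of_mul_pos_left' h0 this
    have : (0:ℝ) < ((a' * x - a * y : ℤ) : ℝ) := by push_cast; exact this
    have : 0 < a' * x - a * y := by exact_mod_cast this
    linarith

theorem cycRel_wf (C : ℕ) {σ σ' : ℝ} (h0 : 0 ≤ σ) (h1 : 0 < σ') :
    WellFounded (CycRel C σ σ') := by
  rw [wellFounded_iff_isEmpty_descending_chain]
  refine ⟨fun ⟨B, hB⟩ => ?_⟩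
  choose x y hx hy hxC hyC hb hlow hgood using hB
  let S : Set (ℤ × ℤ) := {β | (0 ≤ β.1 ∧ 0 ≤ β.2) ∧ ∃ᶠ k in Filter.atTop, (x k, y k) = β}
  have hbox : (Set.Icc (-(C:ℤ)) C ×ˢ Set.Icc (-(C:ℤ)) C).Finite :=
    (Set.finite_Icc _ _).prod (Set.finite_Icc _ _)
  have hmem : ∀ k, (x k, y k) ∈ (Set.Icc (-(C:ℤ)) C ×ˢ Set.Icc (-(C:ℤ)) C) := by
    intro k
    have := abs_le.1 (hxC k)
    have := abs_le.1 (hyC k)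
    simp only [Set.mem_prod, Set.mem_Icc]
    omega
  have hSfin : S.Finite := by
    refine hbox.subset ?_
    rintro β ⟨_, hf⟩
    obtain ⟨k, hk⟩ := hf.exists
    exact hk ▸ hmem k
  have hev : ∀ᶠ k in Filter.atTop, (0 ≤ x k ∧ 0 ≤ y k) → (x k, y k) ∈ S := by
    have : ∀ᶠ k in Filter.atTop, ∀ β ∈ (Set.Icc (-(C:ℤ)) C ×ˢ Set.Icc (-(C:ℤ)) C),
        (0 ≤ β.1 ∧ 0 ≤ β.2) → (x k, y k) = β → β ∈ S := by
      rw [Filter.eventually_all_finite hbox]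
      intro β _
      by_cases hβ : β ∈ S
      · exact Filter.Eventually.of_forall fun k _ _ => hβ
      · by_cases hp : 0 ≤ β.1 ∧ 0 ≤ β.2
        · have : ¬ ∃ᶠ k in Filter.atTop, (x k, y k) = β := fun h => hβ ⟨hp, h⟩
          rw [Filter.not_frequently] at this
          filter_upwards [this] with k hk _ h
          exact absurd h hk
        · exact Filter.Eventually.of_forall fun k h => absurd h hp
    filter_upwards [this] with k hk hp
    exact hk _ (hmem k) hp rfl
  obtain ⟨K, hK⟩ := Filter.eventually_atTop.1 hev
  have hne : S.Nonempty := by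
    by_contra hS
    rw [Set.not_nonempty_iff_eq_empty] at hS
    have hdrop := drop_lemma (fun k => (B k).2) K (by
      intro k hk
      have hnp : ¬ (0 ≤ x k ∧ 0 ≤ y k) := fun h => by
        have := hK k hk h
        rw [hS] at this
        exact this
      have := behind_y_neg h0 h1 (hb k) hnp
      have := hy k
      omega)
    have e := hdrop (((B K).2 + C).toNat + 1)
    have l := hlow (K + ((B K).2 + C).toNat)
    rw [← add_assoc] at e
    push_cast at e
    omega
  obtain ⟨⟨a, a'⟩, hαS, hmax⟩ := Set.exists_max_image S
    (fun β : ℤ × ℤ => (β.2 : ℚ) / (β.1 : ℚ)) hSfin hne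
  obtain ⟨hap, haf⟩ := hαS
  simp only at hap
  have hab : σ * a' - σ' * a < 0 := by
    obtain ⟨k, hk⟩ := haf.exists
    have := hb k
    simp only [Prod.mk.injEq] at hk
    rwa [hk.1, hk.2] at this
  have ha0 := behind_x_pos h0 h1 hab hap
  have hdrop := drop_lemma (fun k => (C + 1) * (a * (B k).2 - a' * (B k).1) - (B k).1) K (by
    intro k hk
    have hxk := abs_le.1 (hxC k)
    simp only [hx k, hy k]
    have key : (C + 1) * (a * y k - a' * x k) - x k ≤ -1 := by
      by_cases hp : 0 ≤ x k ∧ 0 ≤ y k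
      · have hx0 := behind_x_pos h0 h1 (hb k) hp
        have hm := hmax _ (hK k hk hp)
        simp only at hm
        rw [div_le_div_iff₀ (by exact_mod_cast hx0) (by exact_mod_cast ha0)] at hm
        have hm' : y k * a ≤ a' * x k := by exact_mod_cast hm
        have : (0:ℤ) ≤ (C + 1) * (a' * x k - a * y k) :=
          mul_nonneg (by positivity) (by linarith)
        linarith
      · have := behind_cross h0 h1 (hb k) hp hab hap
        have : (0:ℤ) ≤ (C + 1) * (a' * x k - a * y k - 1) :=
          mul_nonneg (by positivity) (by linarith)
        linarith
    linarith)
  set f : ℕ → ℤ := fun k => (C + 1) * (a * (B k).2 - a' * (B k).1) - (B k).1 with hf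
  obtain ⟨k, hk, hka⟩ := Filter.frequently_atTop.1 haf (K + (f K + LBound C).toNat + 1)
  simp only [Prod.mk.injEq] at hka
  have hg := hgood k (by rw [hka.1, hka.2]; exact hap)
  rw [hka.1, hka.2] at hg
  have hg' : -LBound C ≤ f (k+1) := hg
  have e : f (K + (k + 1 - K)) ≤ f K - ((k + 1 - K : ℕ) : ℤ) := hdrop (k + 1 - K)
  have : K + (k + 1 - K) = k + 1 := by omega
  rw [this] at e
  omega

section Paths
variable {Q Q' A : Type}

theorem pathEnd_append (v : Q × Q') (l₁ l₂ : List (PStep Q Q' A)) :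
    pathEnd v (l₁ ++ l₂) = pathEnd (pathEnd v l₁) l₂ := by
  induction l₁ generalizing v with
  | nil => rfl
  | cons s r ih => simp [pathEnd, ih]

theorem isProdPath_append (N : OCN Q A) (N' : OCN Q' A) (v : Q × Q')
    (l₁ l₂ : List (PStep Q Q' A)) :
    IsProdPath N N' v (l₁ ++ l₂) ↔ IsProdPath N N' v l₁ ∧ IsProdPath N N' (pathEnd v l₁) l₂ := by
  induction l₁ generalizing v with
  | nil => simp [IsProdPath, pathEnd]
  | cons s r ih => simp [pathEnd, IsProdPath, ih, and_assoc]

theorem mem_pathNodes (v x : Q × Q') (l : List (PStep Q Q' A)) (h : x ∈ pathNodes v l) :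
    ∃ pre suf, l = pre ++ suf ∧ pathEnd v pre = x := by
  induction l generalizing v with
  | nil =>
    refine ⟨[], [], rfl, ?_⟩
    simp [pathNodes] at h
    simp [pathEnd, h]
  | cons s r ih =>
    simp only [pathNodes, List.map_cons, List.mem_cons] at h
    rcases h with h | h
    · exact ⟨[], s :: r, rfl, by simp [pathEnd, h]⟩
    · obtain ⟨pre, suf, e, hp⟩ := ih (stepTgt s) (by simpa [pathNodes] using h)
      exact ⟨s :: pre, suf, by simp [e], by simpa [pathEnd] using hp⟩

theorem effectsOf_append (l₁ l₂ : List (PStep Q Q' A)) :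
    effectsOf (l₁ ++ l₂) = ((effectsOf l₁).1 + (effectsOf l₂).1,
      (effectsOf l₁).2 + (effectsOf l₂).2) := by
  simp [effectsOf]

theorem effects_bound (N : OCN Q A) (N' : OCN Q' A) (v : Q × Q')
    (l : List (PStep Q Q' A)) (h : IsProdPath N N' v l) :
    |(effectsOf l).1| ≤ l.length ∧ |(effectsOf l).2| ≤ l.length := by
  induction l generalizing v with
  | nil => simp [effectsOf]
  | cons s r ih =>
    obtain ⟨h1, h2, h3⟩ := h
    have := ih _ h3
    have e1 := N.effect_bounded _ _ _ _ h1
    have e2 := N'.effect_bounded _ _ _ _ h2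
    simp only [effectsOf, List.map_cons, List.sum_cons, List.length_cons, abs_le] at this ⊢
    push_cast
    omega

end Paths

/-- One phase of the slope game, with an abstract goal `T` for the next phases. -/
inductive Phase {Q Q' A : Type} (N : OCN Q A) (N' : OCN Q' A) (T : Q × Q' → ℤ → ℤ → Prop) :
    Q × Q' → List (PStep Q Q' A) → ℝ → ℝ → Prop where
  | move (v : Q × Q') (steps : List (PStep Q Q' A)) (ρ ρ' : ℝ)
      (a : A) (d : ℤ) (p : Q)
      (ht : N.δ (pathEnd v steps).1 a d p)
      (hcont : ∀ (d' : ℤ) (p' : Q'), N'.δ (pathEnd v steps).2 a d' p' →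
        ¬ IsLasso v (steps ++ [(a, d, d', (p, p'))]) →
        Phase N N' T v (steps ++ [(a, d, d', (p, p'))]) ρ ρ')
      (hbehind : ∀ (d' : ℤ) (p' : Q'), N'.δ (pathEnd v steps).2 a d' p' →
        IsLasso v (steps ++ [(a, d, d', (p, p'))]) →
        ∀ pre cyc, steps ++ [(a, d, d', (p, p'))] = pre ++ cyc → cyc ≠ [] →
        pathEnd v pre = pathEnd v (steps ++ [(a, d, d', (p, p'))]) →
        Behind ρ ρ' ((effectsOf cyc).1 : ℝ) ((effectsOf cyc).2 : ℝ))
      (hnext : ∀ (d' : ℤ) (p' : Q'), N'.δ (pathEnd v steps).2 a d' p' →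
        IsLasso v (steps ++ [(a, d, d', (p, p'))]) →
        ∀ pre cyc, steps ++ [(a, d, d', (p, p'))] = pre ++ cyc → cyc ≠ [] →
        pathEnd v pre = pathEnd v (steps ++ [(a, d, d', (p, p'))]) →
        PosVec ((effectsOf cyc).1 : ℝ) ((effectsOf cyc).2 : ℝ) →
        T (p, p') (effectsOf cyc).1 (effectsOf cyc).2) :
      Phase N N' T v steps ρ ρ'

/-- Spoiler wins from all positions far enough below a slope slightly steeper than `(α, α')`. -/
def NextGoal {Q Q' A : Type} (N : OCN Q A) (N' : OCN Q' A) (C : ℕ)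
    (w : Q × Q') (α α' : ℤ) : Prop :=
  ∀ n n' : ℕ, (C + 1) * (α * n' - α' * n) - n < -((C : ℤ) * ((C + 1) * (α + α') + 1)) →
    SpoilerWinsSim N N' (w.1, n) (w.2, n')

theorem good_arith (C x y b b' e e' : ℤ) (hC : 0 ≤ C) (hx0 : 0 ≤ x) (hx : x ≤ C)
    (hy0 : 0 ≤ y) (hy : y ≤ C) (he : |e| ≤ C) (he' : |e'| ≤ C)
    (h : -(C * ((C + 1) * (x + y) + 1)) ≤ (C + 1) * (x * (b' + e') - y * (b + e)) - (b + e)) :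
    -(2 * C * ((C + 1) * (2 * C) + 1)) ≤ (C + 1) * (x * b' - y * b) - b := by
  rw [abs_le] at he he'
  have h1 : x * e' ≤ x * C := mul_le_mul_of_nonneg_left he'.2 hx0
  have h2 : y * (-C) ≤ y * e := mul_le_mul_of_nonneg_left he.1 hy0
  have h3 : (x + y) * C ≤ (2 * C) * C := mul_le_mul_of_nonneg_right (by linarith) hC
  have h4 : (C + 1) * (x * e' - y * e) ≤ (C + 1) * (2 * C * C) :=
    mul_le_mul_of_nonneg_left (by linarith) (by linarith)
  have h5 : (C + 1) * ((x + y) * C) ≤ (C + 1) * (2 * C * C) :=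
    mul_le_mul_of_nonneg_left (by linarith) (by linarith)
  nlinarith

theorem phase_main {Q Q' A : Type} (N : OCN Q A) (N' : OCN Q' A) (C : ℕ)
    (hC : ∀ k ∈ AcyclicLenSet N N', k ≤ C)
    (v : Q × Q') (ρ ρ' σ σ' : ℝ) (h0 : 0 ≤ σ) (h1 : 0 < σ')
    (hσ : ∀ x y : ℤ, |x| ≤ C → |y| ≤ C → ρ * y - ρ' * x < 0 → σ * y - σ' * x < 0)
    (B : ℤ × ℤ) :
    ∀ steps, Phase N N' (NextGoal N N' C) v steps ρ ρ' →
      (∀ pre suf, steps = pre ++ suf → Phase N N' (NextGoal N N' C) v pre ρ ρ') →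
      IsProdPath N N' v steps → (pathNodes v steps).Nodup →
      σ * B.2 + C * (σ + σ') < σ' * B.1 →
      ∀ n n' : ℕ, (n : ℤ) = B.1 + (effectsOf steps).1 → (n' : ℤ) = B.2 + (effectsOf steps).2 →
      SpoilerWinsSim N N' ((pathEnd v steps).1, n) ((pathEnd v steps).2, n') := by
  induction B using (cycRel_wf C h0 h1).induction with
  | _ B IH =>
  intro steps hph
  induction hph with
  | move steps ρ ρ' a d p ht hcont hbehind hnext ih =>
  intro hpre hpath hnd hinv n n' hn hn'
  have hlen : steps.length + 1 ≤ C := hC _ ⟨v, steps, hpath, hnd, rfl⟩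
  obtain ⟨eb, eb'⟩ := effects_bound N N' v steps hpath
  rw [abs_le] at eb eb'
  have hd := N.effect_bounded _ _ _ _ ht
  have hBC : (C : ℤ) < B.1 := by
    have hb' : -(C:ℤ) ≤ B.2 := by omega
    have hb'' : -(C:ℝ) ≤ B.2 := by exact_mod_cast hb'
    have : 0 < σ' * ((B.1 : ℝ) - C) := by nlinarith [mul_nonneg h0 (by linarith : (0:ℝ) ≤ B.2 + C)]
    have := pos_of_mul_pos_left' h1.le this
    have : (C : ℝ) < B.1 := by linarith
    exact_mod_cast this
  have hnd0 : 0 ≤ (n : ℤ) + d := by omega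
  obtain ⟨n1, hn1⟩ := Int.eq_ofNat_of_zero_le hnd0
  refine SpoilerWinsSim.move _ _ a (p, n1) ⟨d, ht, hn1.symm⟩ ?_
  rintro ⟨p', n1'⟩ ⟨d', ht', hn1'⟩
  simp only at ht' hn1'
  have hd' := N'.effect_bounded _ _ _ _ ht'
  have hpath1 : IsProdPath N N' v (steps ++ [(a, d, d', (p, p'))]) := by
    rw [isProdPath_append]
    exact ⟨hpath, ht, ht', trivial⟩
  have hend : pathEnd v (steps ++ [(a, d, d', (p, p'))]) = (p, p') := by
    rw [pathEnd_append]; rfl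
  have heff : effectsOf (steps ++ [(a, d, d', (p, p'))]) =
      ((effectsOf steps).1 + d, (effectsOf steps).2 + d') := by
    rw [effectsOf_append]; simp [effectsOf]
  by_cases hl : IsLasso v (steps ++ [(a, d, d', (p, p'))])
  · have hmem := hl.2.2
    rw [List.dropLast_concat] at hmem
    obtain ⟨pre, suf, e, hpe⟩ := mem_pathNodes _ _ _ hmem
    have ecyc : steps ++ [(a, d, d', (p, p'))] = pre ++ (suf ++ [(a, d, d', (p, p'))]) := by
      rw [e, List.append_assoc]
    have hcne : suf ++ [(a, d, d', (p, p'))] ≠ [] := by simp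
    have hbh := hbehind d' p' ht' hl pre _ ecyc hcne hpe
    have hnx := hnext d' p' ht' hl pre _ ecyc hcne hpe
    rw [hend] at hpe
    have hpath2 := hpath1
    rw [ecyc, isProdPath_append] at hpath2
    have hcb := effects_bound N N' _ _ hpath2.2
    have hpb := effects_bound N N' _ _ hpath2.1
    have hlp : pre.length + suf.length = steps.length := by rw [e]; simp
    simp only [List.length_append, List.length_cons, List.length_nil] at hcb
    generalize hcyc : suf ++ [(a, d, d', (p, p'))] = cyc at *
    rw [ecyc, effectsOf_append] at heff
    simp only [Prod.mk.injEq] at heff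
    obtain ⟨hf1, hf2⟩ := heff
    generalize (effectsOf cyc).1 = x at *
    generalize (effectsOf cyc).2 = y at *
    have hxC : |x| ≤ C := by have := hcb.1; push_cast at this; omega
    have hyC : |y| ≤ C := by have := hcb.2; push_cast at this; omega
    have hpb1 : |(effectsOf pre).1| ≤ C := by have := hpb.1; omega
    have hpb2 : |(effectsOf pre).2| ≤ C := by have := hpb.2; omega
    have hs := hσ x y hxC hyC hbh
    have hpos1 : (n1 : ℤ) = (B.1 + x) + (effectsOf pre).1 := by omega
    have hpos2 : (n1' : ℤ) = (B.2 + y) + (effectsOf pre).2 := by omega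
    by_cases hgood : (0 ≤ x ∧ 0 ≤ y) ∧
      (C + 1) * (x * n1' - y * n1) - n1 < -((C : ℤ) * ((C + 1) * (x + y) + 1))
    · refine hnx ⟨by exact_mod_cast hgood.1.1, by exact_mod_cast hgood.1.2, ?_⟩ n1 n1' hgood.2
      rintro ⟨z1, z2⟩
      rw [z1, z2] at hs
      simp at hs
    · have hrel : CycRel C σ σ' (B.1 + x, B.2 + y) B := by
        refine ⟨x, y, rfl, rfl, hxC, hyC, hs, ?_, ?_⟩
        · rw [abs_le] at hpb2
          simp only
          omega
        · intro hp
          have hng : ¬ ((C + 1) * (x * n1' - y * n1) - n1 < -((C : ℤ) * ((C + 1) * (x + y) + 1))) :=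
            fun h => hgood ⟨hp, h⟩
          rw [not_lt, hpos1, hpos2] at hng
          exact good_arith C x y _ _ _ _ (by positivity) hp.1 (le_of_abs_le hxC) hp.2
            (le_of_abs_le hyC) hpb1 hpb2 hng
      have hres := IH _ hrel pre (hpre pre suf e)
        (fun pre' suf' e' => hpre pre' (suf' ++ suf) (by rw [e, e', List.append_assoc]))
        hpath2.1
        (by
          rw [e] at hnd
          simp only [pathNodes, List.map_append, ← List.cons_append] at hnd ⊢
          exact hnd.of_append_left)
        (by push_cast; nlinarith)
        n1 n1' hpos1 hpos2
      rw [hpe] at hres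
      exact hres
  · have hnd1 : (pathNodes v (steps ++ [(a, d, d', (p, p'))])).Nodup := by
      have hnm : (p, p') ∉ pathNodes v steps := by
        intro hm
        refine hl ⟨by simp, ?_, ?_⟩
        · rwa [List.dropLast_concat]
        · rwa [List.dropLast_concat, hend]
      have : pathNodes v (steps ++ [(a, d, d', (p, p'))]) = pathNodes v steps ++ [(p, p')] := by
        simp [pathNodes, stepTgt]
      rw [this, List.nodup_append]
      refine ⟨hnd, by simp, ?_⟩
      intro z hz w hw
      simp only [List.mem_singleton] at hw
      rintro rfl
      exact hnm (hw ▸ hz)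
    have hres := ih d' p' ht' hl hσ IH ?_ hpath1 hnd1 hinv n1 n1'
      (by rw [heff]; simp only; omega) (by rw [heff]; simp only; omega)
    · rw [hend] at hres
      exact hres
    · intro pre suf e
      rcases List.eq_nil_or_concat suf with hs | ⟨suf', s, hs⟩
      · rw [hs, List.append_nil] at e
        rw [← e]
        exact hcont d' p' ht' hl
      · rw [hs, List.concat_eq_append, ← List.append_assoc] at e
        exact hpre pre suf' (List.append_inj_left' e rfl)

theorem phase_nil {Q Q' A : Type} (N : OCN Q A) (N' : OCN Q' A) (C : ℕ)
    (hC : ∀ k ∈ AcyclicLenSet N N', k ≤ C)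
    (v : Q × Q') (ρ ρ' σ σ' : ℝ) (h0 : 0 ≤ σ) (h1 : 0 < σ')
    (hσ : ∀ x y : ℤ, |x| ≤ C → |y| ≤ C → ρ * y - ρ' * x < 0 → σ * y - σ' * x < 0)
    (hp : Phase N N' (NextGoal N N' C) v [] ρ ρ') (n n' : ℕ)
    (hinv : σ * n' + C * (σ + σ') < σ' * n) :
    SpoilerWinsSim N N' (v.1, n) (v.2, n') := by
  refine phase_main N N' C hC v ρ ρ' σ σ' h0 h1 hσ (n, n') [] hp ?_ trivial
    (by simp [pathNodes]) (by simpa using hinv) n n' (by simp [effectsOf]) (by simp [effectsOf])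
  intro pre suf e
  have : pre = [] := by simpa using (List.append_eq_nil_iff.1 e.symm).1
  rw [this]
  exact hp

theorem slope_to_phase {Q Q' A : Type} (N : OCN Q A) (N' : OCN Q' A) (C : ℕ)
    (hC : ∀ k ∈ AcyclicLenSet N N', k ≤ C)
    (v : Q × Q') (steps : List (PStep Q Q' A)) (ρ ρ' : ℝ)
    (h : SlopeSpoilerWins N N' v steps ρ ρ') :
    Phase N N' (NextGoal N N' C) v steps ρ ρ' := by
  induction h with
  | move v steps ρ ρ' a d p ht hcont hbehind hnext ih1 ih2 =>
  refine Phase.move v steps ρ ρ' a d p ht ih1 hbehind ?_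
  intro d' p' ht' hl pre cyc e hne hpe hpv
  have hph := ih2 d' p' ht' hl pre cyc e hne hpe hpv
  generalize (effectsOf cyc).1 = x at *
  generalize (effectsOf cyc).2 = y at *
  intro n n' hg
  have hC1 : (0 : ℝ) < C + 1 := by positivity
  refine phase_nil N N' C hC (p, p') x y ((C + 1) * x) ((C + 1) * y + 1)
    (mul_nonneg hC1.le hpv.1) (by have := mul_nonneg hC1.le hpv.2.1; linarith) ?_ hph n n' ?_
  · intro s t hs ht hb
    have hb' : x * t - y * s < 0 := by exact_mod_cast hb
    have hb'' : (C + 1) * (x * t - y * s) ≤ (C + 1 : ℤ) * (-1) :=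
      mul_le_mul_of_nonneg_left (by omega) (by positivity)
    rw [abs_le] at hs
    have : ((C + 1) * x) * t - ((C + 1) * y + 1) * s < (0 : ℤ) := by nlinarith
    exact_mod_cast this
  · have : ((C + 1) * x) * n' + C * (((C + 1) * x) + ((C + 1) * y + 1))
        < (((C + 1) * y + 1) * n : ℤ) := by nlinarith
    exact_mod_cast this

/-- If Spoiler wins the slope game from position
`((p, p'), (ρ, ρ'))`, then Spoiler wins the simulation game from every
position `(pm, p'm')` such that `(m, m')` is `C`-below `(ρ, ρ')`, where `C`
is 1 plus the maximal length of an acyclic path in the product graph of the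
two nets (which are in normal form). -/
theorem spoiler_transfer {Q Q' A : Type} [Fintype Q] [Fintype Q'] [Fintype A]
    (N : OCN Q A) (N' : OCN Q' A)
    (hN : N.NonBlocking) (hN' : N'.Complete)
    (C : ℕ) (hC : IsGreatest (AcyclicLenSet N N') C)
    (p : Q) (p' : Q') (ρ ρ' : ℝ) (hpos : PosVec ρ ρ')
    (hwin : SlopeSpoilerWins N N' (p, p') [] ρ ρ') :
    ∀ m m' : ℕ, CBelow (C : ℝ) ρ ρ' (m : ℤ) (m' : ℤ) →
      SpoilerWinsSim N N' (p, m) (p', m') := by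
  intro m m' hb
  obtain ⟨r, hr, e1, e2⟩ := hb
  push_cast at e1 e2
  have hC0 : (0 : ℝ) ≤ C := by positivity
  have hm0 : (0 : ℝ) ≤ m' := by positivity
  have hρ' : 0 < ρ' := pos_of_mul_pos_left' hr.le (by linarith : 0 < r * ρ')
  refine phase_nil N N' C (fun k hk => hC.2 hk) (p, p') ρ ρ' ρ ρ' hpos.1 hρ'
    (fun _ _ _ _ h => h)
    (slope_to_phase N N' C (fun k hk => hC.2 hk) _ _ _ _ hwin) m m' ?_
  have f1 := mul_pos hρ' (sub_pos.2 e1)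
  have f2 := mul_nonneg hpos.1 (sub_pos.2 e2).le
  nlinarith
end

section
/- Locality of simulation on one-counter nets: Let (p,p') ∈ Q×Q' be a pair of control states and m,m',n,n' ∈ ℕ. If the ⪯-neighborhoods of (m,m') and of (n,n') agree on every argument (q,q',l,l') ≠ (p,p',0,0), then they also agree on (p,p',0,0); that is, pm ⪯ p'm' if and only if pn ⪯ p'n'. -/
/-- The `R`-neighborhood of `(m, m')` agrees at argument `(q, q', l, l')`
with the `R'`-neighborhood of `(n, n')`: the `⊥`-pattern (whether the shifted
counters are nonnegative) is the same, and when both shifted points exist the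
two relations agree on them. -/
def NHEq {Q Q' : Type} (R R' : Q × ℕ → Q' × ℕ → Prop) (m m' n n' : ℕ)
    (q : Q) (q' : Q') (l l' : ℤ) : Prop :=
  ((0 ≤ (m : ℤ) + l ∧ 0 ≤ (m' : ℤ) + l') ↔ (0 ≤ (n : ℤ) + l ∧ 0 ≤ (n' : ℤ) + l')) ∧
  (0 ≤ (m : ℤ) + l → 0 ≤ (m' : ℤ) + l' → 0 ≤ (n : ℤ) + l → 0 ≤ (n' : ℤ) + l' →
    (R (q, ((m : ℤ) + l).toNat) (q', ((m' : ℤ) + l').toNat) ↔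
     R' (q, ((n : ℤ) + l).toNat) (q', ((n' : ℤ) + l').toNat)))

theorem sim_step {S S' A : Type} {stepL : S → A → S → Prop} {stepR : S' → A → S' → Prop}
    {c : S} {c' : S'} (h : Simulates stepL stepR c c') {a : A} {d : S} (hs : stepL c a d) :
    ∃ d', stepR c' a d' ∧ Simulates stepL stepR d d' := by
  obtain ⟨R, hR, hc⟩ := h
  obtain ⟨d', h1, h2⟩ := hR _ _ hc _ _ hs
  exact ⟨d', h1, R, hR, h2⟩

theorem locality_aux {Q Q' A : Type}
    (N : OCN Q A) (N' : OCN Q' A)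
    (p : Q) (p' : Q') (m m' n n' : ℕ)
    (h : ∀ (q : Q) (q' : Q') (l l' : ℤ),
      -1 ≤ l → l ≤ 1 → -1 ≤ l' → l' ≤ 1 →
      (q, q', l, l') ≠ (p, p', (0 : ℤ), (0 : ℤ)) →
      NHEq (Simulates N.Step N'.Step) (Simulates N.Step N'.Step)
        m m' n n' q q' l l')
    (hs : Simulates N.Step N'.Step (p, m) (p', m')) :
      Simulates N.Step N'.Step (p, n) (p', n') := by
  refine ⟨fun c c' => Simulates N.Step N'.Step c c' ∨ (c = (p, n) ∧ c' = (p', n')), ?_,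
    Or.inr ⟨rfl, rfl⟩⟩
  rintro c c' (hc | ⟨rfl, rfl⟩) a ⟨q, k⟩ hstep
  · obtain ⟨d', h1, h2⟩ := sim_step hc hstep
    exact ⟨d', h1, Or.inl h2⟩
  · obtain ⟨d, hd, hk⟩ := hstep
    simp only at hd hk
    have hdb := N.effect_bounded _ _ _ _ hd
    have hmd : 0 ≤ (m : ℤ) + d := by
      by_cases hd0 : d = 0
      · omega
      · have := (h p p' d 0 (by omega) (by omega) (by omega) (by omega) (by simp [hd0])).1
        omega
    obtain ⟨⟨q', k'⟩, ⟨d', hd', hk'⟩, hsim⟩ :=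
      sim_step hs (a := a) (d := (q, ((m : ℤ) + d).toNat)) ⟨d, hd, by simp [hmd]⟩
    simp only at hd' hk'
    have hdb' := N'.effect_bounded _ _ _ _ hd'
    by_cases he : (q, q', d, d') = (p, p', (0 : ℤ), (0 : ℤ))
    · simp only [Prod.mk.injEq] at he
      obtain ⟨rfl, rfl, rfl, rfl⟩ := he
      refine ⟨(q', n'), ⟨0, hd', by simp⟩, Or.inr ⟨?_, rfl⟩⟩
      have : k = n := by omega
      rw [this]
    · obtain ⟨g1, g2⟩ := h q q' d d' (by omega) (by omega) (by omega) (by omega) he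
      have hm' : 0 ≤ (m' : ℤ) + d' := by omega
      obtain ⟨hn, hn'⟩ := g1.1 ⟨hmd, hm'⟩
      refine ⟨(q', ((n' : ℤ) + d').toNat), ⟨d', hd', by simp [hn']⟩, Or.inl ?_⟩
      have e1 : k' = ((m' : ℤ) + d').toNat := by omega
      have e2 : k = ((n : ℤ) + d).toNat := by omega
      rw [e2]
      rw [e1] at hsim
      exact (g2 hmd hm' hn hn').1 hsim

/-- **Locality.** Let `(p, p')` be a pair of control states and
`m, m', n, n' ∈ ℕ`.  If the `⪯`-neighborhoods of `(m, m')` and `(n, n')`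
agree on every argument `(q, q', l, l') ≠ (p, p', 0, 0)` (with
`l, l' ∈ {-1,0,1}`), then they also agree on `(p, p', 0, 0)`, i.e.
`pm ⪯ p'm'` iff `pn ⪯ p'n'`. -/
theorem locality {Q Q' A : Type} [Fintype Q] [Fintype Q'] [Fintype A]
    (N : OCN Q A) (N' : OCN Q' A)
    (p : Q) (p' : Q') (m m' n n' : ℕ)
    (h : ∀ (q : Q) (q' : Q') (l l' : ℤ),
      -1 ≤ l → l ≤ 1 → -1 ≤ l' → l' ≤ 1 →
      (q, q', l, l') ≠ (p, p', (0 : ℤ), (0 : ℤ)) →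
      NHEq (Simulates N.Step N'.Step) (Simulates N.Step N'.Step)
        m m' n n' q q' l l') :
    (Simulates N.Step N'.Step (p, m) (p', m') ↔
      Simulates N.Step N'.Step (p, n) (p', n')) := by
  refine ⟨locality_aux N N' p p' m m' n n' h, locality_aux N N' p p' n n' m m' ?_⟩
  intro q q' l l' h1 h2 h3 h4 h5
  obtain ⟨g1, g2⟩ := h q q' l l' h1 h2 h3 h4 h5
  exact ⟨g1.symm, fun a b c d => (g2 c d a b).symm⟩
end
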